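/- With G₁ as above and two fixed distinct vertices v₁, v₂ ∈ [n], P(deg(v₁) > 0 and deg(v₂) > 0) = E[ ((X̃₁)₂/(n)₂) · ( Q₁ + (1−Q₁)(1 − (1−Q₁)^{(X̃₁−2)_+})² ) ], where (x)₂ = x(x−1). -/

import Mathlib

open MeasureTheory

/-- Discrete measurable structure on permutations of `Fin n`. -/
instance permMeasurableSpace (n : ℕ) : MeasurableSpace (Equiv.Perm (Fin n)) := ⊤

lemma perm_count (n x : ℕ) (hx : x ≤ n) (v₁ v₂ : Fin n) (hv : v₁ ≠ v₂) :
    n * (n - 1) * (Finset.univ.filter (fun σ : Equiv.Perm (Fin n) =>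
      (σ.symm v₁ : ℕ) < x ∧ (σ.symm v₂ : ℕ) < x)).card = n.factorial * (x * (x - 1)) := by
  classical
  have key : ∀ w : Fin n × Fin n, w ∈ (Finset.univ : Finset (Fin n)).offDiag →
      (Finset.univ.filter (fun σ : Equiv.Perm (Fin n) =>
        (σ.symm w.1 : ℕ) < x ∧ (σ.symm w.2 : ℕ) < x)).card =
      (Finset.univ.filter (fun σ : Equiv.Perm (Fin n) =>
        (σ.symm v₁ : ℕ) < x ∧ (σ.symm v₂ : ℕ) < x)).card := by
    rintro ⟨a, b⟩ hab
    simp only [Finset.mem_offDiag, Finset.mem_univ, true_and] at hab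
    obtain ⟨τ, h1, h2⟩ : ∃ τ : Equiv.Perm (Fin n), τ a = v₁ ∧ τ b = v₂ := by
      refine ⟨(Equiv.swap a v₁).trans (Equiv.swap (Equiv.swap a v₁ b) v₂), ?_, ?_⟩
      · simp only [Equiv.trans_apply, Equiv.swap_apply_left]
        apply Equiv.swap_apply_of_ne_of_ne _ hv
        intro h
        apply hab
        apply (Equiv.swap a v₁).injective
        simpa using h
      · simp
    have h1' : τ.symm v₁ = a := by simp [← h1]
    have h2' : τ.symm v₂ = b := by simp [← h2]
    refine Finset.card_bij' (fun σ _ => σ.trans τ) (fun σ _ => σ.trans τ.symm) ?_ ?_ ?_ ?_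
    · intro σ h; simpa [h1', h2'] using h
    · intro σ h; simpa [h1, h2] using h
    · intro σ h; ext; simp
    · intro σ h; ext; simp
  have hs := Finset.sum_congr rfl key
  rw [Finset.sum_const, Finset.offDiag_card, smul_eq_mul] at hs
  simp only [Finset.card_filter] at hs
  rw [Finset.sum_comm] at hs
  have inner : ∀ σ : Equiv.Perm (Fin n), (∑ w ∈ (Finset.univ : Finset (Fin n)).offDiag,
      if (σ.symm w.1 : ℕ) < x ∧ (σ.symm w.2 : ℕ) < x then 1 else 0) = x * (x - 1) := by
    intro σ
    rw [← Finset.card_filter]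
    have : (Finset.univ : Finset (Fin n)).offDiag.filter
      (fun w => (σ.symm w.1 : ℕ) < x ∧ (σ.symm w.2 : ℕ) < x) =
      ((Finset.univ.filter (fun i : Fin n => (i : ℕ) < x)).map σ.toEmbedding).offDiag := by
      ext ⟨a, b⟩
      simp [Finset.mem_offDiag]
      tauto
    rw [this, Finset.offDiag_card, Finset.card_map, Fin.card_filter_val_lt, min_eq_right hx,
      Nat.mul_sub, mul_one]
  rw [Finset.sum_congr rfl (fun σ _ => inner σ)] at hs
  simp only [Finset.sum_const, Finset.card_univ, Fintype.card_perm, Fintype.card_fin,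
    smul_eq_mul] at hs
  rw [hs, Nat.mul_sub, mul_one, Finset.card_filter]

instance unitInterval_restrict_prob : IsProbabilityMeasure (volume.restrict (Set.Icc (0 : ℝ) 1)) := ⟨by simp⟩

lemma box_meas {ι : Type*} [Fintype ι] (F : Finset ι) (q : ℝ) (hq : q ∈ Set.Icc (0:ℝ) 1) :
    (Measure.pi fun _ : ι => volume.restrict (Set.Icc (0 : ℝ) 1)).real
      {m | ∀ e ∈ F, q ≤ m e} = (1 - q) ^ F.card := by
  classical
  have : {m : ι → ℝ | ∀ e ∈ F, q ≤ m e} =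
      Set.univ.pi (fun e => if e ∈ F then Set.Ici q else Set.univ) := by
    ext m
    simp only [Set.mem_ofPred_eq, Set.mem_pi, Set.mem_univ, true_imp_iff]
    refine forall_congr' fun e => ?_
    split_ifs with h <;> simp [h]
  rw [this, measureReal_def, Measure.pi_pi, ENNReal.toReal_prod]
  have h2 : ∀ e : ι, ((volume.restrict (Set.Icc (0 : ℝ) 1))
      (if e ∈ F then Set.Ici q else Set.univ)).toReal = if e ∈ F then (1 - q) else 1 := by
    intro e
    split_ifs
    · rw [Measure.restrict_apply measurableSet_Ici]
      have : Set.Ici q ∩ Set.Icc 0 1 = Set.Icc q 1 := by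
        ext y; simp only [Set.mem_inter_iff, Set.mem_Ici, Set.mem_Icc]
        exact ⟨fun h => ⟨h.1, h.2.2⟩, fun h => ⟨h.1, hq.1.trans h.1, h.2⟩⟩
      rw [this, Real.volume_Icc, ENNReal.toReal_ofReal (by linarith [hq.2])]
    · simp
  simp_rw [h2]
  simp

lemma box_measurable {ι : Type*} [Fintype ι] (F : Finset ι) (q : ℝ) :
    MeasurableSet {m : ι → ℝ | ∀ e ∈ F, q ≤ m e} := by
  have : {m : ι → ℝ | ∀ e ∈ F, q ≤ m e} = ⋂ e ∈ F, {m | q ≤ m e} := by ext; simp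
  rw [this]
  exact Finset.measurableSet_biInter _ fun e _ => measurableSet_le measurable_const (measurable_pi_apply e)

lemma section_meas (n : ℕ) (A : Finset (Fin n)) (v₁ v₂ : Fin n) (hv : v₁ ≠ v₂)
    (h1 : v₁ ∈ A) (h2 : v₂ ∈ A) (q : ℝ) (hq : q ∈ Set.Icc (0:ℝ) 1) :
    (Measure.pi fun _ : Sym2 (Fin n) => volume.restrict (Set.Icc (0 : ℝ) 1)).real
      {m | (∃ u, u ≠ v₁ ∧ u ∈ A ∧ m s(v₁, u) < q) ∧ (∃ u, u ≠ v₂ ∧ u ∈ A ∧ m s(v₂, u) < q)}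
      = q + (1 - q) * (1 - (1 - q) ^ (A.card - 2)) ^ 2 := by
  classical
  set F₁ := (A.erase v₁).image (fun u => s(v₁, u)) with hF₁
  set F₂ := (A.erase v₂).image (fun u => s(v₂, u)) with hF₂
  have inj : ∀ v : Fin n, Function.Injective (fun u : Fin n => s(v, u)) := by
    intro v a b h
    exact Sym2.congr_right.mp h
  have c1 : F₁.card = A.card - 1 := by
    rw [hF₁, Finset.card_image_of_injective _ (inj _), Finset.card_erase_of_mem h1]
  have c2 : F₂.card = A.card - 1 := by
    rw [hF₂, Finset.card_image_of_injective _ (inj _), Finset.card_erase_of_mem h2]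
  have hi : F₁ ∩ F₂ = {s(v₁, v₂)} := by
    ext e
    simp only [hF₁, hF₂, Finset.mem_inter, Finset.mem_image, Finset.mem_erase,
      Finset.mem_singleton]
    constructor
    · rintro ⟨⟨a, ⟨ha, ha'⟩, rfl⟩, b, ⟨hb, hb'⟩, h⟩
      rw [Sym2.eq_iff] at h
      rcases h with ⟨h, h'⟩ | ⟨h, h'⟩
      · exact absurd h.symm hv
      · rw [h]
    · rintro rfl
      exact ⟨⟨v₂, ⟨hv.symm, h2⟩, rfl⟩, v₁, ⟨hv, h1⟩, Sym2.eq_swap⟩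
  have hA : 2 ≤ A.card := by
    have := Finset.card_le_card (show ({v₁, v₂} : Finset (Fin n)) ⊆ A by
      intro a; simp; rintro (rfl | rfl) <;> assumption)
    rwa [Finset.card_pair hv] at this
  obtain ⟨k, hk⟩ := Nat.exists_eq_add_of_le hA
  have cu : (F₁ ∪ F₂).card = 2 * k + 1 := by
    have := Finset.card_union_add_card_inter F₁ F₂
    rw [hi, c1, c2, Finset.card_singleton] at this
    omega
  set ν := (Measure.pi fun _ : Sym2 (Fin n) => volume.restrict (Set.Icc (0 : ℝ) 1)) with hν
  have hS : {m : Sym2 (Fin n) → ℝ | (∃ u, u ≠ v₁ ∧ u ∈ A ∧ m s(v₁, u) < q) ∧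
      (∃ u, u ≠ v₂ ∧ u ∈ A ∧ m s(v₂, u) < q)} =
      ({m | ∀ e ∈ F₁, q ≤ m e} ∪ {m | ∀ e ∈ F₂, q ≤ m e})ᶜ := by
    ext m
    simp [hF₁, hF₂, and_assoc]
  have hI : {m : Sym2 (Fin n) → ℝ | ∀ e ∈ F₁, q ≤ m e} ∩ {m | ∀ e ∈ F₂, q ≤ m e} =
      {m | ∀ e ∈ F₁ ∪ F₂, q ≤ m e} := by
    ext m
    simp only [Set.mem_inter_iff, Set.mem_ofPred_eq, Finset.mem_union, or_imp, forall_and]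
  rw [hS, probReal_compl_eq_one_sub ((box_measurable _ _).union (box_measurable _ _))]
  have hu := measureReal_union_add_inter (μ := ν)
    (s := {m : Sym2 (Fin n) → ℝ | ∀ e ∈ F₁, q ≤ m e}) (box_measurable F₂ q)
  rw [hI, box_meas _ _ hq, box_meas _ _ hq, box_meas _ _ hq, cu, c1, c2, hk] at hu
  rw [eq_sub_of_add_eq hu, hk, show 2 + k - 1 = k + 1 by omega, show 2 + k - 2 = k by omega]
  ring

/-- Model of the random graph `G₁`: a uniformly random permutation `σ` of `[n]`
(its first `X̃₁` positions give the uniformly random vertex set `V₁`), and i.i.d.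
uniform `[0,1]` marks on unordered pairs (a pair of vertices of `V₁` is an edge iff
its mark is `< Q₁`), all independent of `(X̃₁, Q₁)`.  Then for fixed distinct vertices
`v₁ ≠ v₂`,
`P(deg(v₁) > 0 ∧ deg(v₂) > 0)
  = E[((X̃₁)₂/(n)₂) (Q₁ + (1−Q₁)(1 − (1−Q₁)^{(X̃₁−2)_+})²)]`. -/
theorem stmt16 {Ω₀ : Type*} [MeasurableSpace Ω₀] (μ₀ : Measure Ω₀) [IsProbabilityMeasure μ₀]
    (n : ℕ) (hn : 2 ≤ n) (X : Ω₀ → ℕ) (Q : Ω₀ → ℝ) (hX : Measurable X) (hQ : Measurable Q)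
    (hXn : ∀ ω, X ω ≤ n) (hQ01 : ∀ ω, Q ω ∈ Set.Icc (0 : ℝ) 1)
    (v₁ v₂ : Fin n) (hv : v₁ ≠ v₂) :
    (((μ₀.prod ((PMF.uniformOfFintype (Equiv.Perm (Fin n))).toMeasure)).prod
        (Measure.pi fun _ : Sym2 (Fin n) => volume.restrict (Set.Icc (0 : ℝ) 1)))
      {ω : (Ω₀ × Equiv.Perm (Fin n)) × (Sym2 (Fin n) → ℝ) |
        ((ω.1.2.symm v₁ : ℕ) < X ω.1.1 ∧
          ∃ u : Fin n, u ≠ v₁ ∧ (ω.1.2.symm u : ℕ) < X ω.1.1 ∧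
            ω.2 s(v₁, u) < Q ω.1.1) ∧
        ((ω.1.2.symm v₂ : ℕ) < X ω.1.1 ∧
          ∃ u : Fin n, u ≠ v₂ ∧ (ω.1.2.symm u : ℕ) < X ω.1.1 ∧
            ω.2 s(v₂, u) < Q ω.1.1)}).toReal
      = ∫ ω, ((X ω : ℝ) * ((X ω : ℝ) - 1)) / ((n : ℝ) * ((n : ℝ) - 1))
            * (Q ω + (1 - Q ω) * (1 - (1 - Q ω) ^ (X ω - 2)) ^ 2) ∂μ₀ := by
  classical
  set ν := (Measure.pi fun _ : Sym2 (Fin n) => volume.restrict (Set.Icc (0 : ℝ) 1)) with hν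
  set U := (PMF.uniformOfFintype (Equiv.Perm (Fin n))).toMeasure with hU
  set S := {ω : (Ω₀ × Equiv.Perm (Fin n)) × (Sym2 (Fin n) → ℝ) |
        ((ω.1.2.symm v₁ : ℕ) < X ω.1.1 ∧
          ∃ u : Fin n, u ≠ v₁ ∧ (ω.1.2.symm u : ℕ) < X ω.1.1 ∧
            ω.2 s(v₁, u) < Q ω.1.1) ∧
        ((ω.1.2.symm v₂ : ℕ) < X ω.1.1 ∧
          ∃ u : Fin n, u ≠ v₂ ∧ (ω.1.2.symm u : ℕ) < X ω.1.1 ∧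
            ω.2 s(v₂, u) < Q ω.1.1)} with hS
  have hXm : Measurable (fun ω : (Ω₀ × Equiv.Perm (Fin n)) × (Sym2 (Fin n) → ℝ) => X ω.1.1) :=
    hX.comp (measurable_fst.comp measurable_fst)
  have hQm : Measurable (fun ω : (Ω₀ × Equiv.Perm (Fin n)) × (Sym2 (Fin n) → ℝ) => Q ω.1.1) :=
    hQ.comp (measurable_fst.comp measurable_fst)
  have mV : ∀ u : Fin n, MeasurableSet
      {ω : (Ω₀ × Equiv.Perm (Fin n)) × (Sym2 (Fin n) → ℝ) | (ω.1.2.symm u : ℕ) < X ω.1.1} := by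
    intro u
    refine measurableSet_lt ?_ hXm
    have : Measurable (fun σ : Equiv.Perm (Fin n) => (σ.symm u : ℕ)) := measurable_from_top
    exact this.comp (measurable_snd.comp measurable_fst)
  have mE : ∀ v : Fin n, MeasurableSet
      {ω : (Ω₀ × Equiv.Perm (Fin n)) × (Sym2 (Fin n) → ℝ) |
        ∃ u : Fin n, u ≠ v ∧ (ω.1.2.symm u : ℕ) < X ω.1.1 ∧ ω.2 s(v, u) < Q ω.1.1} := by
    intro v
    simp only [Set.ofPred_exists]
    refine MeasurableSet.iUnion fun u => ?_
    refine (MeasurableSet.const (u ≠ v)).inter ((mV u).inter ?_)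
    exact measurableSet_lt ((measurable_pi_apply _).comp measurable_snd) hQm
  have mS : MeasurableSet S := ((mV v₁).inter (mE v₁)).inter ((mV v₂).inter (mE v₂))
  set g : ℕ → ℝ → ℝ := fun x q => q + (1 - q) * (1 - (1 - q) ^ (x - 2)) ^ 2 with hg
  have hg0 : ∀ x q, q ∈ Set.Icc (0:ℝ) 1 → 0 ≤ g x q := by
    intro x q hq
    have := hq.1
    have : 0 ≤ 1 - q := by linarith [hq.2]
    simp only [hg]; positivity
  have sec : ∀ ω : Ω₀, ∀ σ : Equiv.Perm (Fin n), ν.real (Prod.mk (ω, σ) ⁻¹' S) =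
      Set.indicator {σ : Equiv.Perm (Fin n) | (σ.symm v₁ : ℕ) < X ω ∧ (σ.symm v₂ : ℕ) < X ω}
        (fun _ => g (X ω) (Q ω)) σ := by
    intro ω σ
    by_cases h : (σ.symm v₁ : ℕ) < X ω ∧ (σ.symm v₂ : ℕ) < X ω
    · rw [Set.indicator_of_mem (by exact h)]
      set A := (Finset.univ.filter (fun i : Fin n => (i : ℕ) < X ω)).map σ.toEmbedding with hA
      have memA : ∀ u, u ∈ A ↔ (σ.symm u : ℕ) < X ω := by
        intro u
        simp [hA]
      have cA : A.card = X ω := by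
        rw [hA, Finset.card_map, Fin.card_filter_val_lt, min_eq_right (hXn ω)]
      have := section_meas n A v₁ v₂ hv ((memA _).2 h.1) ((memA _).2 h.2) (Q ω) (hQ01 ω)
      rw [cA] at this
      refine Eq.trans ?_ this
      congr 1
      ext m
      simp only [hS, Set.mem_preimage, Set.mem_ofPred_eq, memA, h.1, h.2, true_and]
    · rw [Set.indicator_of_notMem (by exact h)]
      have : Prod.mk (ω, σ) ⁻¹' S = ∅ := by
        ext m
        simp only [hS, Set.mem_preimage, Set.mem_ofPred_eq, Set.mem_empty_iff_false, iff_false]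
        exact fun hh => h ⟨hh.1.1, hh.2.1⟩
      rw [this]; simp
  have hn2 : (2:ℝ) ≤ n := by exact_mod_cast hn
  have cnt : ∀ ω : Ω₀, U.real {σ : Equiv.Perm (Fin n) |
      (σ.symm v₁ : ℕ) < X ω ∧ (σ.symm v₂ : ℕ) < X ω} =
      ((X ω : ℝ) * ((X ω : ℝ) - 1)) / ((n : ℝ) * ((n : ℝ) - 1)) := by
    intro ω
    have h := perm_count n (X ω) (hXn ω) v₁ v₂ hv
    have h' : ((n:ℝ) * (n - 1)) * ((Finset.univ.filter (fun σ : Equiv.Perm (Fin n) =>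
      (σ.symm v₁ : ℕ) < X ω ∧ (σ.symm v₂ : ℕ) < X ω)).card : ℝ) =
        n.factorial * (X ω * (X ω - 1)) := by
      have e : ∀ k : ℕ, ((k * (k - 1) : ℕ) : ℝ) = k * (k - 1) := by
        intro k; cases k <;> simp
      rw [← e, ← e]
      exact_mod_cast h
    rw [measureReal_def, hU, PMF.toMeasure_uniformOfFintype_apply _ (by exact trivial),
      ENNReal.toReal_div, ENNReal.toReal_natCast, ENNReal.toReal_natCast, Fintype.card_perm,
      Fintype.card_fin, div_eq_div_iff (by positivity)
        (mul_ne_zero (by linarith) (by linarith))]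
    rw [Fintype.card_subtype]
    simp only [Set.mem_ofPred_eq]
    linarith
  have i1 : Integrable (fun p => ν.real (Prod.mk p ⁻¹' S)) (μ₀.prod U) := by
    refine Integrable.of_bound (C := 1) ?_ ?_
    · exact (measurable_measure_prodMk_left mS).ennreal_toReal.aestronglyMeasurable
    · refine Filter.Eventually.of_forall fun p => ?_
      rw [Real.norm_of_nonneg measureReal_nonneg]
      exact measureReal_le_one
  have e1 : (((μ₀.prod U).prod ν) S).toReal = ∫ p, ν.real (Prod.mk p ⁻¹' S) ∂(μ₀.prod U) := by
    rw [Measure.prod_apply mS]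
    exact (integral_toReal (measurable_measure_prodMk_left mS).aemeasurable
      (Filter.Eventually.of_forall fun p => measure_lt_top _ _)).symm
  rw [e1, integral_prod _ i1]
  refine integral_congr_ae (Filter.Eventually.of_forall fun ω => ?_)
  simp only [sec]
  rw [integral_indicator_const _ (by exact trivial), cnt, smul_eq_mul]
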